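/- arXiv:2310.11083 — 5 statements merged into one kernel-verified Lean document; each statement's English description precedes it below -/
import Mathlib

section
/- Let (H, dist) be a pseudometric space and let f be a map from the vertices of the unbalanced signed triangle C₃⁻ to H such that f ∘ ψ = f for every sign-preserving automorphism ψ of C₃⁻. Then f(v₀) = f(v₁), hence dist(f(v₀), f(v₁)) = 0, and both conditions (a) and (b) of adequate representation fail at v₀: there is no ε > 0 with dist(f(v₀), f(v₁)) > ε, and dist(f(v₀), f(v₂)) < dist(f(v₀), f(v₁)) is impossible. In particular, f(v₀) is not an adequate representation of v₀. -/
/-- A signed graph: a finite simple graph together with a sign function on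
unordered pairs of vertices (`true` = positive edge, `false` = negative edge). -/
structure SignedGraph (V : Type*) where
  G : SimpleGraph V
  sign : Sym2 V → Bool

namespace SignedGraph

/-- The set `N⁺(v)` of positive neighbors of `v`. -/
def posSet {V : Type*} (S : SignedGraph V) (v : V) : Set V :=
  {u | S.G.Adj v u ∧ S.sign s(v, u) = true}

/-- The set `N⁻(v)` of negative neighbors of `v`. -/
def negSet {V : Type*} (S : SignedGraph V) (v : V) : Set V :=
  {u | S.G.Adj v u ∧ S.sign s(v, u) = false}

/-- A sign-preserving automorphism of a signed graph: a permutation of the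
vertices preserving adjacency and edge signs. -/
def IsSignAuto {V : Type*} (S : SignedGraph V) (ψ : Equiv.Perm V) : Prop :=
  (∀ u v, S.G.Adj (ψ u) (ψ v) ↔ S.G.Adj u v) ∧
  (∀ u v, S.G.Adj u v → S.sign s(ψ u, ψ v) = S.sign s(u, v))

/-- `f v` is an adequate representation of the vertex `v`:
(a) some `ε > 0` separates `f v` from the images of all negative neighbors, and
(b) images of positive neighbors are strictly closer than those of negative
neighbors. -/
def Adequate {V H : Type*} [PseudoMetricSpace H] (S : SignedGraph V) (f : V → H)
    (v : V) : Prop :=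
  (∃ ε > 0, ∀ u ∈ S.negSet v, dist (f v) (f u) > ε) ∧
  (∀ u ∈ S.posSet v, ∀ w ∈ S.negSet v, dist (f v) (f u) < dist (f v) (f w))

end SignedGraph

/-- The underlying (unsigned) cycle graph on `ZMod n`: `u` and `v` are adjacent
iff they differ by one. -/
def cycleGraph (n : ℕ) : SimpleGraph (ZMod n) :=
  SimpleGraph.fromRel (fun u v => v = u + 1)

instance (n : ℕ) : DecidableRel (cycleGraph n).Adj := fun u v =>
  decidable_of_iff (u ≠ v ∧ (v = u + 1 ∨ u = v + 1))
    (by unfold cycleGraph; exact (SimpleGraph.fromRel_adj (fun a b => b = a + 1) u v).symm)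

/-- The singly-negative signed `n`-cycle `Cₙ⁻`: vertices `0, …, n - 1` in
`ZMod n`, edges between consecutive vertices, with the edge `{0, 1}` negative
and all other edges positive. -/
def negCycle (n : ℕ) : SignedGraph (ZMod n) where
  G := cycleGraph n
  sign := fun e => !(decide (e = s((0 : ZMod n), (1 : ZMod n))))

instance (n : ℕ) : DecidableRel (negCycle n).G.Adj :=
  inferInstanceAs (DecidableRel (cycleGraph n).Adj)

/-- The transposition exchanging the endpoints of the negative edge is a sign-preserving
automorphism of `C₃⁻`. -/
theorem isSignAuto_negCycle_three_swap :
    (negCycle 3).IsSignAuto (Equiv.swap (0 : ZMod 3) 1) := by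
  constructor <;> decide

theorem one_mem_negSet_negCycle_three : (1 : ZMod 3) ∈ (negCycle 3).negSet 0 :=
  ⟨by decide, by decide⟩

open SignedGraph in
/-- Any map on the vertices of `C₃⁻` that is invariant under every
sign-preserving automorphism identifies `f v₀` and `f v₁`; hence both
conditions of adequate representation fail at `v₀`, and `f v₀` is not an
adequate representation of `v₀`. -/
theorem negCycle3_not_adequate {H : Type*} [PseudoMetricSpace H]
    (f : ZMod 3 → H)
    (hf : ∀ ψ : Equiv.Perm (ZMod 3), (negCycle 3).IsSignAuto ψ → f ∘ ψ = f) :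
    f 0 = f 1 ∧ dist (f 0) (f 1) = 0 ∧
    ¬ (∃ ε > (0 : ℝ), dist (f 0) (f 1) > ε) ∧
    ¬ (dist (f 0) (f 2) < dist (f 0) (f 1)) ∧
    ¬ (negCycle 3).Adequate f 0 := by
  have h01 : f 0 = f 1 := by
    simpa using (congrFun (hf _ isSignAuto_negCycle_three_swap) 0).symm
  have hdist : dist (f 0) (f 1) = 0 := by rw [h01, dist_self]
  have hsep : ¬ ∃ ε > (0 : ℝ), dist (f 0) (f 1) > ε := by
    rintro ⟨ε, hε, h⟩
    linarith
  refine ⟨h01, hdist, hsep, ?_, ?_⟩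
  · rw [hdist]
    exact dist_nonneg.not_gt
  · rintro ⟨⟨ε, hε, h⟩, -⟩
    exact hsep ⟨ε, hε, h 1 one_mem_negSet_negCycle_three⟩
end

section
/- In the unbalanced signed triangle C₃⁻ with constant initial labels X⁰(v₀) = X⁰(v₁) = X⁰(v₂) = c, for every iteration ℓ ≥ 1 the extended Weisfeiler–Lehman labels of v₀ and v₁ coincide: Xℓ_B(v₀) = Xℓ_B(v₁) and Xℓ_U(v₀) = Xℓ_U(v₁). -/
namespace SignedGraph

/-- The finset `N⁺(v)` of positive neighbors of `v`. -/
def posNeighbors {V : Type*} (S : SignedGraph V) [Fintype V] [DecidableEq V]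
    [DecidableRel S.G.Adj] (v : V) : Finset V :=
  Finset.univ.filter fun u => S.G.Adj v u ∧ S.sign s(v, u) = true

/-- The finset `N⁻(v)` of negative neighbors of `v`. -/
def negNeighbors {V : Type*} (S : SignedGraph V) [Fintype V] [DecidableEq V]
    [DecidableRel S.G.Adj] (v : V) : Finset V :=
  Finset.univ.filter fun u => S.G.Adj v u ∧ S.sign s(v, u) = false

end SignedGraph

/-- The type of extended Weisfeiler–Lehman labels at iteration `n + 1`:
at the first iteration a label is a pair of the initial label and a multiset of
initial labels; afterwards it is a triple of a previous label and two multisets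
of previous labels. -/
def WLType (L : Type v) : ℕ → Type v
  | 0 => L × Multiset L
  | (n + 1) => WLType L n × Multiset (WLType L n) × Multiset (WLType L n)

namespace SignedGraph

/-- `wlPair S X0 n v = (X_B(v), X_U(v))` at iteration `n + 1`: index `0`
corresponds to the first WL iteration. -/
def wlPair {V L : Type*} [Fintype V] [DecidableEq V] (S : SignedGraph V)
    [DecidableRel S.G.Adj] (X0 : V → L) :
    (n : ℕ) → V → WLType L n × WLType L n
  | 0, v =>
      ((X0 v, (S.posNeighbors v).val.map X0),
       (X0 v, (S.negNeighbors v).val.map X0))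
  | (n + 1), v =>
      (((wlPair S X0 n v).1,
        (S.posNeighbors v).val.map (fun u => (wlPair S X0 n u).1),
        (S.negNeighbors v).val.map (fun u => (wlPair S X0 n u).2)),
       ((wlPair S X0 n v).2,
        (S.posNeighbors v).val.map (fun u => (wlPair S X0 n u).2),
        (S.negNeighbors v).val.map (fun u => (wlPair S X0 n u).1)))

/-- The extended WL balanced label `Xℓ_B(v)` of the signed graph `S` with
initial labels `X0`, for iterations `ℓ ≥ 1`. -/
def XB {V L : Type*} [Fintype V] [DecidableEq V] (S : SignedGraph V)
    [DecidableRel S.G.Adj] (X0 : V → L) (ℓ : ℕ) (v : V) : WLType L (ℓ - 1) :=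
  (S.wlPair X0 (ℓ - 1) v).1

/-- The extended WL unbalanced label `Xℓ_U(v)` of the signed graph `S` with
initial labels `X0`, for iterations `ℓ ≥ 1`. -/
def XU {V L : Type*} [Fintype V] [DecidableEq V] (S : SignedGraph V)
    [DecidableRel S.G.Adj] (X0 : V → L) (ℓ : ℕ) (v : V) : WLType L (ℓ - 1) :=
  (S.wlPair X0 (ℓ - 1) v).2

end SignedGraph

theorem negCycle_three_posNeighbors_zero : (negCycle 3).posNeighbors 0 = {2} := by decide

theorem negCycle_three_posNeighbors_one : (negCycle 3).posNeighbors 1 = {2} := by decide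

theorem negCycle_three_negNeighbors_zero : (negCycle 3).negNeighbors 0 = {1} := by decide

theorem negCycle_three_negNeighbors_one : (negCycle 3).negNeighbors 1 = {0} := by decide

/-- The two endpoints of the negative edge of `C₃⁻` have the same pair of labels as soon as
their initial labels agree. -/
theorem negCycle_three_wlPair_zero_eq_one {L : Type*} (X₀ : ZMod 3 → L) (h : X₀ 0 = X₀ 1) (n : ℕ) :
    (negCycle 3).wlPair X₀ n 0 = (negCycle 3).wlPair X₀ n 1 := by
  induction n with
  | zero =>
    simp only [SignedGraph.wlPair, negCycle_three_posNeighbors_zero,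
      negCycle_three_posNeighbors_one, negCycle_three_negNeighbors_zero,
      negCycle_three_negNeighbors_one, Finset.singleton_val, Multiset.map_singleton, h]
  | succ n ih =>
    simp only [SignedGraph.wlPair, negCycle_three_posNeighbors_zero,
      negCycle_three_posNeighbors_one, negCycle_three_negNeighbors_zero,
      negCycle_three_negNeighbors_one, Finset.singleton_val, Multiset.map_singleton, ih]

open SignedGraph in
/-- In the unbalanced signed triangle `C₃⁻` with constant initial labels, the
extended WL labels of `v₀` and `v₁` coincide at every iteration `ℓ ≥ 1`. -/
theorem negTriangle_wl_labels_eq {L : Type*} (X₀ : ZMod 3 → L) (c : L)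
    (hX : ∀ v : ZMod 3, X₀ v = c) :
    ∀ ℓ : ℕ, 1 ≤ ℓ →
      (negCycle 3).XB X₀ ℓ 0 = (negCycle 3).XB X₀ ℓ 1 ∧
      (negCycle 3).XU X₀ ℓ 0 = (negCycle 3).XU X₀ ℓ 1 := by
  intro ℓ _
  have h := negCycle_three_wlPair_zero_eq_one X₀ ((hX 0).trans (hX 1).symm) (ℓ - 1)
  exact ⟨congrArg Prod.fst h, congrArg Prod.snd h⟩
end

section
/- Let (H, dist) be a pseudometric space and let f be a map from the vertices of the singly-negative signed 4-cycle C₄⁻ to H such that f ∘ ψ = f for every sign-preserving automorphism ψ of C₄⁻. Then f(v₀) = f(v₁), hence dist(f(v₀), f(v₁)) = 0, and both conditions (a) and (b) of adequate representation fail at v₀: there is no ε > 0 with dist(f(v₀), f(v₁)) > ε, and dist(f(v₀), f(v₃)) < dist(f(v₀), f(v₁)) is impossible. In particular, f(v₀) is not an adequate representation of v₀. -/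
/-- The reflection `u ↦ 1 - u` is a sign-preserving automorphism of `Cₙ⁻`. -/
theorem negCycle_isSignAuto_subLeft (n : ℕ) :
    (negCycle n).IsSignAuto (Equiv.subLeft (1 : ZMod n)) := by
  refine ⟨fun u v => ?_, fun u v _ => ?_⟩
  · simp only [negCycle, cycleGraph, SimpleGraph.fromRel_adj, Equiv.subLeft_apply]
    grind
  · simp only [negCycle, Equiv.subLeft_apply, Sym2.eq_iff]
    congr 2
    grind

theorem negCycle_one_mem_negSet (n : ℕ) (h : (0 : ZMod n) ≠ 1) :
    (1 : ZMod n) ∈ (negCycle n).negSet 0 := by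
  simp [SignedGraph.negSet, negCycle, cycleGraph, h]

open SignedGraph in
/-- Any map on the vertices of `C₄⁻` that is invariant under every
sign-preserving automorphism identifies `f v₀` and `f v₁`; hence both
conditions of adequate representation fail at `v₀`, and `f v₀` is not an
adequate representation of `v₀`. -/
theorem negCycle4_not_adequate {H : Type*} [PseudoMetricSpace H]
    (f : ZMod 4 → H)
    (hf : ∀ ψ : Equiv.Perm (ZMod 4), (negCycle 4).IsSignAuto ψ → f ∘ ψ = f) :
    f 0 = f 1 ∧ dist (f 0) (f 1) = 0 ∧
    ¬ (∃ ε > (0 : ℝ), dist (f 0) (f 1) > ε) ∧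
    ¬ (dist (f 0) (f 3) < dist (f 0) (f 1)) ∧
    ¬ (negCycle 4).Adequate f 0 := by
  have h01 : f 0 = f 1 := by
    simpa using (congrFun (hf _ (negCycle_isSignAuto_subLeft 4)) 0).symm
  have hd : dist (f 0) (f 1) = 0 := by rw [h01, dist_self]
  refine ⟨h01, hd, ?_, ?_, ?_⟩
  · rintro ⟨ε, hε, h⟩
    linarith
  · rw [hd]
    exact not_lt.mpr dist_nonneg
  · rintro ⟨⟨ε, hε, h⟩, -⟩
    linarith [h 1 (negCycle_one_mem_negSet 4 (by decide))]
end

section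
/- Let (H, dist) be a pseudometric space and let f be a map from the vertices of the singly-negative signed 5-cycle C₅⁻ to H such that f ∘ ψ = f for every sign-preserving automorphism ψ of C₅⁻. Then f(v₀) = f(v₁), hence dist(f(v₀), f(v₁)) = 0, and both conditions (a) and (b) of adequate representation fail at v₀: there is no ε > 0 with dist(f(v₀), f(v₁)) > ε, and dist(f(v₀), f(v₄)) < dist(f(v₀), f(v₁)) is impossible. In particular, f(v₀) is not an adequate representation of v₀. -/
/-- The reflection `x ↦ 1 - x` is a sign-preserving automorphism of `C₅⁻`. -/
theorem negCycle5_isSignAuto_subLeft :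
    (negCycle 5).IsSignAuto (Equiv.subLeft (1 : ZMod 5)) := by
  constructor <;> decide

open SignedGraph in
/-- Any map on the vertices of `C₅⁻` that is invariant under every
sign-preserving automorphism identifies `f v₀` and `f v₁`; hence both
conditions of adequate representation fail at `v₀`, and `f v₀` is not an
adequate representation of `v₀`. -/
theorem negCycle5_not_adequate {H : Type*} [PseudoMetricSpace H]
    (f : ZMod 5 → H)
    (hf : ∀ ψ : Equiv.Perm (ZMod 5), (negCycle 5).IsSignAuto ψ → f ∘ ψ = f) :
    f 0 = f 1 ∧ dist (f 0) (f 1) = 0 ∧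
    ¬ (∃ ε > (0 : ℝ), dist (f 0) (f 1) > ε) ∧
    ¬ (dist (f 0) (f 4) < dist (f 0) (f 1)) ∧
    ¬ (negCycle 5).Adequate f 0 := by
  have h01 : f 0 = f 1 := by
    simpa using (congrFun (hf _ negCycle5_isSignAuto_subLeft) 0).symm
  have hd : dist (f 0) (f 1) = 0 := by rw [h01, dist_self]
  have hneg : (1 : ZMod 5) ∈ (negCycle 5).negSet 0 :=
    ⟨by decide, by decide⟩
  refine ⟨h01, hd, ?_, ?_, ?_⟩
  · rintro ⟨ε, hε, h⟩
    linarith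
  · rw [hd]
    exact not_lt.mpr dist_nonneg
  · rintro ⟨⟨ε, hε, h⟩, -⟩
    have := h 1 hneg
    linarith
end

section
/- For every n ≥ 3: let (H, dist) be a pseudometric space and let f be a map from the vertices of the singly-negative signed n-cycle Cₙ⁻ to H such that f ∘ ψ = f for every sign-preserving automorphism ψ of Cₙ⁻. Then f(v₀) = f(v₁), hence dist(f(v₀), f(v₁)) = 0, and both conditions (a) and (b) of adequate representation fail at v₀ (v₁ is a negative neighbor of v₀ at distance 0, and v_{n−1} is a positive neighbor of v₀ that cannot be strictly closer than distance 0). In particular, f(v₀) is not an adequate representation of v₀, so no automorphism-invariant embedding yields adequate representations for the edges of Cₙ⁻ incident to v₀. -/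
theorem cycleGraph_adj_iff {n : ℕ} {u v : ZMod n} :
    (cycleGraph n).Adj u v ↔ u ≠ v ∧ (v = u + 1 ∨ u = v + 1) :=
  SimpleGraph.fromRel_adj (fun a b => b = a + 1) u v

theorem one_mem_negSet_negCycle {n : ℕ} (hn : 2 ≤ n) :
    (1 : ZMod n) ∈ (negCycle n).negSet 0 := by
  have : Fact (1 < n) := ⟨hn⟩
  refine ⟨cycleGraph_adj_iff.2 ⟨zero_ne_one, Or.inl (zero_add 1).symm⟩, ?_⟩
  simp [negCycle]

theorem neg_one_mem_posSet_negCycle {n : ℕ} (hn : 3 ≤ n) :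
    (-1 : ZMod n) ∈ (negCycle n).posSet 0 := by
  have : Fact (2 < n) := ⟨hn⟩
  have : Fact (1 < n) := ⟨by omega⟩
  refine ⟨cycleGraph_adj_iff.2
    ⟨(neg_ne_zero.2 one_ne_zero).symm, Or.inr (neg_add_cancel 1).symm⟩, ?_⟩
  simp [negCycle, ZMod.neg_one_ne_one]

open SignedGraph in
/-- For every `n ≥ 3`: any map on the vertices of `Cₙ⁻` invariant under every
sign-preserving automorphism identifies `f v₀` and `f v₁`; the vertex `v₁` is a
negative neighbor of `v₀` at distance `0` and `v_{n-1}` is a positive neighbor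
of `v₀`, so both conditions of adequacy fail at `v₀` and `f v₀` is not an
adequate representation of `v₀`. -/
theorem negCycle_not_adequate (n : ℕ) (hn : 3 ≤ n) {H : Type*}
    [PseudoMetricSpace H] (f : ZMod n → H)
    (hf : ∀ ψ : Equiv.Perm (ZMod n), (negCycle n).IsSignAuto ψ → f ∘ ψ = f) :
    f 0 = f 1 ∧ dist (f 0) (f 1) = 0 ∧
    ((1 : ZMod n) ∈ (negCycle n).negSet 0 ∧
      ¬ (∃ ε > (0 : ℝ), ∀ u ∈ (negCycle n).negSet 0, dist (f 0) (f u) > ε)) ∧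
    ((((n - 1 : ℕ) : ZMod n)) ∈ (negCycle n).posSet 0 ∧
      ¬ (∀ u ∈ (negCycle n).posSet 0, ∀ w ∈ (negCycle n).negSet 0,
          dist (f 0) (f u) < dist (f 0) (f w))) ∧
    ¬ (negCycle n).Adequate f 0 := by
  have hEq : f 0 = f 1 := by
    simpa using (congrFun (hf _ (negCycle_isSignAuto_subLeft n)) 0).symm
  have hDist : dist (f 0) (f 1) = 0 := by rw [hEq, dist_self]
  have hNeg : (1 : ZMod n) ∈ (negCycle n).negSet 0 := one_mem_negSet_negCycle (by omega)
  have hPos : ((n - 1 : ℕ) : ZMod n) ∈ (negCycle n).posSet 0 := by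
    have hCast : ((n - 1 : ℕ) : ZMod n) = -1 := by
      rw [Nat.cast_sub (by omega), ZMod.natCast_self, Nat.cast_one, zero_sub]
    exact hCast ▸ neg_one_mem_posSet_negCycle hn
  have hSep : ¬ ∃ ε > (0 : ℝ), ∀ u ∈ (negCycle n).negSet 0, dist (f 0) (f u) > ε := by
    rintro ⟨ε, hε, h⟩
    linarith [h 1 hNeg]
  refine ⟨hEq, hDist, ⟨hNeg, hSep⟩, ⟨hPos, fun h => ?_⟩, fun h => hSep h.1⟩
  exact absurd (h _ hPos _ hNeg) (hDist ▸ dist_nonneg.not_gt)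
end
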